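/- For every ε ∈ [0,1/2], the optimal manipulability among Condorcet-consistent tournament rules on ε-bounded tournaments is α₂(𝒯^ε) = ε/3 + 2ε²/3: there exists a Condorcet-consistent tournament rule r with α₂^r(𝒯^ε) ≤ ε/3 + 2ε²/3, and every Condorcet-consistent tournament rule r satisfies α₂^r(𝒯^ε) ≥ ε/3 + 2ε²/3. -/

import Mathlib

open scoped Classical
open Finset

/-! ## Basic tournament notions -/

/-- The set of potential matches among `n` teams: ordered pairs `(i, j)` with `i < j`. -/
abbrev MatchPair (n : ℕ) := {q : Fin n × Fin n // q.1 < q.2}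

/-- A deterministic (round robin) tournament on `n` teams: for each pair `i < j`,
`true` means that `i` beats `j`. -/
abbrev Outcome (n : ℕ) := MatchPair n → Bool

/-- `Outcome.beats o i j` holds when team `i` beats team `j` (it is `false` when `i = j`). -/
def Outcome.beats {n : ℕ} (o : Outcome n) (i j : Fin n) : Bool :=
  if h : i < j then o ⟨(i, j), h⟩
  else if h' : j < i then !o ⟨(j, i), h'⟩
  else false

/-- An independent probabilistic tournament on `n` teams: `p i j` is the probability
that `i` beats `j`, with `p i j + p j i = 1` for `i ≠ j`. -/
structure ProbTournament (n : ℕ) where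
  p : Fin n → Fin n → ℝ
  mem_Icc : ∀ i j : Fin n, p i j ∈ Set.Icc (0 : ℝ) 1
  compl : ∀ i j : Fin n, i ≠ j → p i j + p j i = 1

/-- The probability of the deterministic outcome `o` when all matches are independent
with probabilities given by `T`. -/
noncomputable def ProbTournament.prob {n : ℕ} (T : ProbTournament n) (o : Outcome n) : ℝ :=
  ∏ e : MatchPair n, (if o e then T.p e.val.1 e.val.2 else T.p e.val.2 e.val.1)

/-- `rP r T i`: the probability that team `i` wins when rule `r` is applied to the
independent probabilistic tournament `T`. -/
noncomputable def rP (r : ∀ n : ℕ, Outcome n → Fin n → ℝ) {n : ℕ}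
    (T : ProbTournament n) (i : Fin n) : ℝ :=
  ∑ o : Outcome n, T.prob o * r n o i

/-- `rPS r T S`: the probability that the winner lies in `S`. -/
noncomputable def rPS (r : ∀ n : ℕ, Outcome n → Fin n → ℝ) {n : ℕ}
    (T : ProbTournament n) (S : Finset (Fin n)) : ℝ :=
  ∑ i ∈ S, rP r T i

/-- A tournament rule assigns a probability distribution over the teams to every
deterministic tournament. -/
def IsTournamentRule (r : ∀ n : ℕ, Outcome n → Fin n → ℝ) : Prop :=
  (∀ (n : ℕ) (o : Outcome n) (i : Fin n), 0 ≤ r n o i) ∧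
  (∀ n : ℕ, 0 < n → ∀ o : Outcome n, ∑ i : Fin n, r n o i = 1)

/-- A rule is Condorcet-consistent if an undefeated team wins with probability 1. -/
def CondorcetConsistent (r : ∀ n : ℕ, Outcome n → Fin n → ℝ) : Prop :=
  ∀ (n : ℕ) (o : Outcome n) (i : Fin n),
    (∀ j : Fin n, j ≠ i → Outcome.beats o i j = true) → r n o i = 1

/-- Two independent probabilistic tournaments are `S`-adjacent if they agree on every
match that is not between two members of `S`. -/
def Adjacent {n : ℕ} (S : Finset (Fin n)) (T T' : ProbTournament n) : Prop :=
  ∀ i j : Fin n, ¬(i ∈ S ∧ j ∈ S) → T.p i j = T'.p i j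

/-- Weakly ε-bounded: all match probabilities lie in `[1/2 - ε, 1/2 + ε]`. -/
def WeaklyBounded (ε : ℝ) (n : ℕ) (T : ProbTournament n) : Prop :=
  ∀ i j : Fin n, i ≠ j → T.p i j ∈ Set.Icc (1/2 - ε) (1/2 + ε)

/-- Strictly ε-bounded: all match probabilities lie in `{1/2 - ε, 1/2 + ε}`. -/
def StrictlyBounded (ε : ℝ) (n : ℕ) (T : ProbTournament n) : Prop :=
  ∀ i j : Fin n, i ≠ j → T.p i j = 1/2 - ε ∨ T.p i j = 1/2 + ε

/-- `alph r k C`: the manipulability `α_k^r(C)`, i.e. the supremum over tournaments in the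
class `C` (on any number of teams), sets `S` of at most `k` teams, and `S`-adjacent
manipulations `T'`, of the gain `r_S(T') - r_S(T)`. -/
noncomputable def alph (r : ∀ n : ℕ, Outcome n → Fin n → ℝ) (k : ℕ)
    (C : ∀ n : ℕ, ProbTournament n → Prop) : ℝ :=
  sSup {x : ℝ | ∃ (n : ℕ) (T T' : ProbTournament n) (S : Finset (Fin n)),
    C n T ∧ S.card ≤ k ∧ Adjacent S T T' ∧ x = rPS r T' S - rPS r T S}

/-! ## Anonymity -/

/-- The relabeling of an outcome by a permutation `σ`: in `permOutcome σ o`,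
team `σ i` beats team `σ j` exactly when `i` beats `j` in `o`. -/
def permOutcome {n : ℕ} (σ : Equiv.Perm (Fin n)) (o : Outcome n) : Outcome n :=
  fun e => Outcome.beats o (σ.symm e.val.1) (σ.symm e.val.2)

/-- A tournament rule is anonymous if relabeling the teams relabels the winner
distribution accordingly. -/
def IsAnonymous (r : ∀ n : ℕ, Outcome n → Fin n → ℝ) : Prop :=
  ∀ (n : ℕ) (σ : Equiv.Perm (Fin n)) (o : Outcome n) (i : Fin n),
    r n (permOutcome σ o) (σ i) = r n o i

/-! ## Elimination rules and recursive tournament rules -/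

/-- An elimination rule: for every number `n > 1` of teams, a distribution `d n` over
sets `M` of matches to be played, with `1 ≤ |M| ≤ n - 1` on the support. -/
structure ElimRule where
  d : ∀ n : ℕ, Finset (MatchPair n) → ℝ
  nonneg : ∀ (n : ℕ) (M : Finset (MatchPair n)), 0 ≤ d n M
  sum_one : ∀ n : ℕ, 1 < n → ∑ M : Finset (MatchPair n), d n M = 1
  supp : ∀ (n : ℕ) (M : Finset (MatchPair n)), 1 < n → d n M ≠ 0 →
    1 ≤ M.card ∧ M.card ≤ n - 1

/-- A set of matches is a matching when no team appears in two distinct matches. -/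
def IsMatchingSet {n : ℕ} (M : Finset (MatchPair n)) : Prop :=
  ∀ e ∈ M, ∀ e' ∈ M, e ≠ e' →
    e.val.1 ≠ e'.val.1 ∧ e.val.1 ≠ e'.val.2 ∧ e.val.2 ≠ e'.val.1 ∧ e.val.2 ≠ e'.val.2

/-- A matching elimination rule only ever selects matchings. -/
def ElimRule.IsMatchingRule (E : ElimRule) : Prop :=
  ∀ (n : ℕ) (M : Finset (MatchPair n)), E.d n M ≠ 0 → IsMatchingSet M

/-- Team `i` loses one of the matches in `M` under the outcome `o`. -/
def losesIn {n : ℕ} (o : Outcome n) (M : Finset (MatchPair n)) (i : Fin n) : Prop :=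
  ∃ e ∈ M, (e.val.1 = i ∧ Outcome.beats o e.val.2 i = true) ∨
           (e.val.2 = i ∧ Outcome.beats o e.val.1 i = true)

/-- The teams surviving the matches `M` (i.e. not losing any match of `M`). -/
noncomputable def survivors {n : ℕ} (o : Outcome n) (M : Finset (MatchPair n)) :
    Finset (Fin n) :=
  Finset.univ.filter (fun i => ¬ losesIn o M i)

/-- The induced sub-outcome on the teams of `s`, reindexed by `Fin s.card` in
increasing order. -/
noncomputable def restrictOutcome {n : ℕ} (o : Outcome n) (s : Finset (Fin n)) :
    Outcome s.card :=
  fun e => Outcome.beats o (↑(s.orderIsoOfFin rfl e.val.1)) (↑(s.orderIsoOfFin rfl e.val.2))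

/-- The induced probabilistic subtournament on the teams of `s` (same match
probabilities), reindexed by `Fin s.card` in increasing order. -/
noncomputable def restrictProb {n : ℕ} (T : ProbTournament n) (s : Finset (Fin n)) :
    ProbTournament s.card where
  p a b := T.p ↑(s.orderIsoOfFin rfl a) ↑(s.orderIsoOfFin rfl b)
  mem_Icc _ _ := T.mem_Icc _ _
  compl a b hab := T.compl _ _
    (fun h => hab ((s.orderIsoOfFin rfl).injective (Subtype.coe_injective h)))

/-- The subset of `Fin s.card` corresponding to the members of `S` that lie in `s`. -/
noncomputable def mapTeams {n : ℕ} (s : Finset (Fin n)) (S : Finset (Fin n)) :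
    Finset (Fin s.card) :=
  Finset.univ.filter (fun a => (↑(s.orderIsoOfFin rfl a) : Fin n) ∈ S)

/-- Fueled recursion computing the winner distribution of the recursive tournament rule
`r^E`: sample `M ← E(n)`, eliminate all losers of matches in `M`, recurse on survivors. -/
noncomputable def recWinAux (E : ElimRule) : ℕ → ∀ n : ℕ, Outcome n → Fin n → ℝ
  | 0, n, _, _ => if n = 1 then 1 else 0
  | fuel + 1, n, o, i =>
    if n ≤ 1 then (if n = 1 then 1 else 0)
    else ∑ M : Finset (MatchPair n), E.d n M *
      (if h : i ∈ survivors o M then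
        recWinAux E fuel (survivors o M).card (restrictOutcome o (survivors o M))
          (((survivors o M).orderIsoOfFin rfl).symm ⟨i, h⟩)
      else 0)

/-- The recursive tournament rule `r^E` determined by the elimination rule `E`. -/
noncomputable def recWin (E : ElimRule) : ∀ n : ℕ, Outcome n → Fin n → ℝ :=
  fun n => recWinAux E n n

/-- `matchMem M u v`: the match between `u` and `v` belongs to `M`. -/
def matchMem {n : ℕ} (M : Finset (MatchPair n)) (u v : Fin n) : Prop :=
  ∃ e ∈ M, e.val = (u, v) ∨ e.val = (v, u)

/-- `valAfter r T M S`: the expected probability that the winner lies in `S` when the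
matches in `M` are played with outcomes drawn from `T`, the losers are eliminated, and
`r` is then run on the induced probabilistic subtournament `T|_M` of the survivors
(with the convention that eliminated teams win with probability `0`). -/
noncomputable def valAfter (r : ∀ n : ℕ, Outcome n → Fin n → ℝ) {n : ℕ}
    (T : ProbTournament n) (M : Finset (MatchPair n)) (S : Finset (Fin n)) : ℝ :=
  ∑ o : Outcome n, T.prob o *
    rPS r (restrictProb T (survivors o M)) (mapTeams (survivors o M) S)

/-- `U` is a base case for the manipulating coalition `S` under rule `r`:
no `S`-adjacent manipulation gains anything, i.e. `α_S^r(U) = 0`. -/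
def IsBaseCase (r : ∀ n : ℕ, Outcome n → Fin n → ℝ) {m : ℕ}
    (U : ProbTournament m) (S : Finset (Fin m)) : Prop :=
  ∀ U' : ProbTournament m, Adjacent S U U' → rPS r U' S - rPS r U S ≤ 0

/-! ## Gauntlets -/

/-- The tournament obtained from `o` by letting `u` beat every other team, keeping all
other matches intact. -/
def condorcetify {n : ℕ} (o : Outcome n) (u : Fin n) : Outcome n :=
  fun e => if e.val.1 = u then true else if e.val.2 = u then false else o e

/-- The opponents of `u` among the matches in `M`. -/
noncomputable def opponents {n : ℕ} (M : Finset (MatchPair n)) (u : Fin n) :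
    Finset (Fin n) :=
  (M.filter (fun e => e.val.1 = u)).image (fun e => e.val.2) ∪
  (M.filter (fun e => e.val.2 = u)).image (fun e => e.val.1)

/-- Fueled recursion for the distribution of the gauntlet of `u`: the set of opponents
that `u` plays in elimination matches when `r^E` is executed on a tournament in which
`u` beats everybody (the input `o` is assumed already so modified).  The value is the
probability, over the internal randomness of `E`, that the gauntlet equals `g`
(recorded as a set of teams of the outermost tournament). -/
noncomputable def gauntletDistAux (E : ElimRule) :
    ℕ → ∀ n : ℕ, Outcome n → Fin n → Finset (Fin n) → ℝ
  | 0, _, _, _, g => if g = ∅ then 1 else 0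
  | fuel + 1, n, o, u, g =>
    if n ≤ 1 then (if g = ∅ then 1 else 0)
    else ∑ M : Finset (MatchPair n), E.d n M *
      (if h : u ∈ survivors o M ∧ opponents M u ⊆ g ∧ g \ opponents M u ⊆ survivors o M then
        gauntletDistAux E fuel (survivors o M).card (restrictOutcome o (survivors o M))
          (((survivors o M).orderIsoOfFin rfl).symm ⟨u, h.1⟩)
          (Finset.univ.filter (fun a =>
            (↑((survivors o M).orderIsoOfFin rfl a) : Fin n) ∈ g \ opponents M u))
      else 0)

/-- `gauntletDist E n o u g`: the probability that the gauntlet `G^{r^E}_u(o)` of team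
`u` in the deterministic tournament `o` equals the set `g`. -/
noncomputable def gauntletDist (E : ElimRule) (n : ℕ) (o : Outcome n) (u : Fin n)
    (g : Finset (Fin n)) : ℝ :=
  gauntletDistAux E n n (condorcetify o u) u g

/-- `gauntletProbP E T u g`: the probability that the gauntlet `G^{r^E}_u(T)` of team `u`
in the independent probabilistic tournament `T` equals the set `g` (first sampling a
deterministic tournament from `T`, then the gauntlet). -/
noncomputable def gauntletProbP (E : ElimRule) {n : ℕ} (T : ProbTournament n)
    (u : Fin n) (g : Finset (Fin n)) : ℝ :=
  ∑ o : Outcome n, T.prob o * gauntletDist E n o u g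

/-- Given the first-round outcome `o` and matches `M`, the probability that the gauntlet
of team `x` in the surviving probabilistic subtournament `T|_M` equals the set `g`
(where `g` is recorded with the original team labels). -/
noncomputable def gauntletEventProb (E : ElimRule) {n : ℕ} (T : ProbTournament n)
    (M : Finset (MatchPair n)) (x : Fin n) (g : Finset (Fin n)) (o : Outcome n) : ℝ :=
  if h : x ∈ survivors o M ∧ g ⊆ survivors o M then
    gauntletProbP E (restrictProb T (survivors o M))
      (((survivors o M).orderIsoOfFin rfl).symm ⟨x, h.1⟩)
      (Finset.univ.filter (fun a =>
        (↑((survivors o M).orderIsoOfFin rfl a) : Fin n) ∈ g))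
  else 0

/-! ## Randomized Death Match -/

/-- Fueled recursion for Randomized Death Match: pick one of the `n.choose 2` matches
uniformly at random, eliminate the loser, recurse. -/
noncomputable def RDMAux : ℕ → ∀ n : ℕ, Outcome n → Fin n → ℝ
  | 0, n, _, _ => if n = 1 then 1 else 0
  | fuel + 1, n, o, i =>
    if n ≤ 1 then (if n = 1 then 1 else 0)
    else ((n.choose 2 : ℝ))⁻¹ * ∑ e : MatchPair n,
      (if h : i ∈ survivors o {e} then
        RDMAux fuel (survivors o {e}).card (restrictOutcome o (survivors o {e}))
          (((survivors o {e}).orderIsoOfFin rfl).symm ⟨i, h⟩)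
      else 0)

/-- Randomized Death Match. -/
noncomputable def RDM : ∀ n : ℕ, Outcome n → Fin n → ℝ :=
  fun n => RDMAux n n

/-! ## Randomized Single Elimination Bracket -/

/-- `nextPow2 n = 2 ^ ⌈log₂ n⌉`. -/
def nextPow2 (n : ℕ) : ℕ := 2 ^ Nat.clog 2 n

/-- Extend a tournament on `n` teams to `nextPow2 n` teams by adding dummy teams that
lose to all original teams (among themselves, the dummy with lower index wins). -/
def extendOutcome {n : ℕ} (o : Outcome n) : Outcome (nextPow2 n) :=
  fun e =>
    if h : (e.val.2 : ℕ) < n then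
      Outcome.beats o ⟨(e.val.1 : ℕ), lt_trans (Fin.lt_def.mp e.2) h⟩ ⟨(e.val.2 : ℕ), h⟩
    else true

/-- Fueled recursion for Randomized Single Elimination Bracket (after dummies have been
added): pick a uniformly random maximum matching on the remaining teams, play those
matches, eliminate all losers, recurse. -/
noncomputable def RSEBAux : ℕ → ∀ n : ℕ, Outcome n → Fin n → ℝ
  | 0, n, _, _ => if n = 1 then 1 else 0
  | fuel + 1, n, o, i =>
    if n ≤ 1 then (if n = 1 then 1 else 0)
    else
      ((Finset.univ.filter
          (fun M : Finset (MatchPair n) => IsMatchingSet M ∧ M.card = n / 2)).card : ℝ)⁻¹ *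
        ∑ M ∈ Finset.univ.filter
            (fun M : Finset (MatchPair n) => IsMatchingSet M ∧ M.card = n / 2),
          (if h : i ∈ survivors o M then
            RSEBAux fuel (survivors o M).card (restrictOutcome o (survivors o M))
              (((survivors o M).orderIsoOfFin rfl).symm ⟨i, h⟩)
          else 0)

/-- Randomized Single Elimination Bracket. -/
noncomputable def RSEB : ∀ n : ℕ, Outcome n → Fin n → ℝ :=
  fun n o i =>
    RSEBAux (nextPow2 n) (nextPow2 n) (extendOutcome o)
      (Fin.castLE (Nat.le_pow_clog one_lt_two n) i)

/-! ## Auxiliary: the elimination polynomial of Randomized Death Match -/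

/-- Winning weight of team `i` on the set `s` (of size `k + 1`) when random matches
are played and losers are eliminated; `p x y` is the chance that `x` beats `y`. -/
noncomputable def Phi {V : Type} [DecidableEq V] (p : V → V → ℝ) : ℕ → Finset V → V → ℝ
  | 0, s, i => if i ∈ s then 1 else 0
  | k + 1, s, i => 2 / (((k : ℝ) + 2) * ((k : ℝ) + 1)) *
      ∑ y ∈ s, (∑ x ∈ s, p x y) * Phi p k (s.erase y) i

section PhiBasics
variable {V : Type} [DecidableEq V]

lemma Phi_congr {p p' : V → V → ℝ} (k : ℕ) : ∀ (s : Finset V) (i : V),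
    (∀ x ∈ s, ∀ y ∈ s, p x y = p' x y) → Phi p k s i = Phi p' k s i := by
  induction k with
  | zero => intro s i _; rfl
  | succ k ih =>
    intro s i h
    simp only [Phi]
    congr 1
    refine Finset.sum_congr rfl fun y hy => ?_
    rw [ih (s.erase y) i (fun a ha b hb => h a (Finset.mem_of_mem_erase ha) b
      (Finset.mem_of_mem_erase hb))]
    congr 1
    exact Finset.sum_congr rfl fun x hx => h x hx y hy

lemma Phi_nonneg {p : V → V → ℝ} (hp : ∀ x y, 0 ≤ p x y) (k : ℕ) : ∀ (s : Finset V) (i : V),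
    0 ≤ Phi p k s i := by
  induction k with
  | zero => intro s i; simp only [Phi]; split_ifs <;> norm_num
  | succ k ih =>
    intro s i
    simp only [Phi]
    refine mul_nonneg (by positivity) (Finset.sum_nonneg fun y _ => mul_nonneg
      (Finset.sum_nonneg fun x _ => hp x y) (ih _ _))

lemma Phi_notMem {p : V → V → ℝ} (k : ℕ) : ∀ (s : Finset V) (i : V), i ∉ s →
    Phi p k s i = 0 := by
  induction k with
  | zero => intro s i h; simp [Phi, h]
  | succ k ih =>
    intro s i h
    simp only [Phi]
    rw [Finset.sum_eq_zero, mul_zero]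
    intro y _
    rw [ih _ _ (fun hh => h (Finset.mem_of_mem_erase hh)), mul_zero]

/-- total weight of the matches inside `s` -/
lemma total_weight {p : V → V → ℝ} (h0 : ∀ x, p x x = 0)
    (h1 : ∀ x y, x ≠ y → p x y + p y x = 1) (s : Finset V) :
    ∑ y ∈ s, ∑ x ∈ s, p x y = (s.card : ℝ) * ((s.card : ℝ) - 1) / 2 := by
  have e : ∑ y ∈ s, ∑ x ∈ s, (p x y + p y x) = (s.card : ℝ) * ((s.card : ℝ) - 1) := by
    have : ∀ y ∈ s, ∑ x ∈ s, (p x y + p y x) = (s.card : ℝ) - 1 := by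
      intro y hy
      rw [← Finset.add_sum_erase _ _ hy, h0]
      rw [Finset.sum_congr rfl (g := fun _ => (1 : ℝ))
        (fun x hx => h1 x y (Finset.ne_of_mem_erase hx))]
      rw [Finset.sum_const, Finset.card_erase_of_mem hy, nsmul_eq_mul,
        Nat.cast_sub (Finset.card_pos.mpr ⟨y, hy⟩)]
      push_cast; ring
    rw [Finset.sum_congr rfl this, Finset.sum_const, nsmul_eq_mul]
  simp only [Finset.sum_add_distrib] at e
  rw [Finset.sum_comm (f := fun y x => p y x)] at e
  linarith

lemma Phi_sum {p : V → V → ℝ} (h0 : ∀ x, p x x = 0)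
    (h1 : ∀ x y, x ≠ y → p x y + p y x = 1) (k : ℕ) : ∀ s : Finset V, s.card = k + 1 →
    ∑ i ∈ s, Phi p k s i = 1 := by
  induction k with
  | zero =>
    intro s hs
    simp only [Phi]
    rw [Finset.sum_congr rfl (g := fun _ => (1 : ℝ)) (fun x hx => if_pos hx)]
    simp [hs]
  | succ k ih =>
    intro s hs
    simp only [Phi]
    rw [← Finset.mul_sum, Finset.sum_comm]
    have : ∀ y ∈ s, ∑ i ∈ s, (∑ x ∈ s, p x y) * Phi p k (s.erase y) i = ∑ x ∈ s, p x y := by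
      intro y hy
      rw [← Finset.mul_sum, ← Finset.add_sum_erase s (fun i => Phi p k (s.erase y) i) hy,
        Phi_notMem _ _ _ (Finset.notMem_erase y s),
        ih _ (by rw [Finset.card_erase_of_mem hy, hs]; rfl)]
      ring
    rw [Finset.sum_congr rfl this, total_weight h0 h1, hs]
    push_cast
    field_simp
    ring

lemma Phi_condorcet {p : V → V → ℝ} (h0 : ∀ x, p x x = 0)
    (h1 : ∀ x y, x ≠ y → p x y + p y x = 1) (i : V) (hi : ∀ x, x ≠ i → p i x = 1) (k : ℕ) :
    ∀ s : Finset V, s.card = k + 1 → i ∈ s → Phi p k s i = 1 := by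
  induction k with
  | zero => intro s _ h; simp [Phi, h]
  | succ k ih =>
    intro s hs his
    simp only [Phi]
    have : ∀ y ∈ s, (∑ x ∈ s, p x y) * Phi p k (s.erase y) i = ∑ x ∈ s, p x y := by
      intro y hy
      by_cases hyi : y = i
      · subst hyi
        rw [Finset.sum_eq_zero, zero_mul]
        intro x _
        by_cases hx : x = y
        · rw [hx, h0]
        · have := h1 x y hx
          have := hi x hx
          linarith
      · rw [ih _ (by rw [Finset.card_erase_of_mem hy, hs]; rfl)
          (Finset.mem_erase.mpr ⟨fun h => hyi h.symm, his⟩), mul_one]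
    rw [Finset.sum_congr rfl this, total_weight h0 h1, hs]
    push_cast
    field_simp
    ring

/-- recursion for a single distinguished team -/
lemma Phi_insert {p : V → V → ℝ} (h0 : ∀ x, p x x = 0) (k : ℕ) (u : V) (A : Finset V)
    (hu : u ∉ A) :
    Phi p (k + 1) (insert u A) u = 2 / (((k : ℝ) + 2) * ((k : ℝ) + 1)) *
      ∑ y ∈ A, (p u y + ∑ x ∈ A, p x y) * Phi p k (insert u (A.erase y)) u := by
  simp only [Phi]
  rw [Finset.sum_insert hu, Phi_notMem _ _ _ (by simp), mul_zero, zero_add]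
  congr 1
  refine Finset.sum_congr rfl fun y hy => ?_
  rw [Finset.sum_insert hu, Finset.erase_insert_of_ne (fun h : u = y => hu (h ▸ hy))]

lemma pow_sub_le {a b : ℝ} (hb : 0 ≤ b) (hab : b ≤ a) (h : a + b = 1) (i : ℕ) :
    a ^ i - b ^ i ≤ a - b := by
  induction i with
  | zero => simp; linarith
  | succ i ih =>
    rcases Nat.eq_zero_or_pos i with hi | hi
    · subst hi; simp
    · have hbi : b ^ i ≤ b := by
        calc b ^ i ≤ b ^ 1 := pow_le_pow_of_le_one hb (by linarith) hi
          _ = b := pow_one b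
      have : a ^ (i+1) - b ^ (i+1) = a * (a ^ i - b ^ i) + b ^ i * (a - b) := by ring
      rw [this]
      nlinarith

lemma Phi_gap {p : V → V → ℝ} {a b : ℝ} (hb : 0 ≤ b) (hab : b ≤ a) (hs : a + b = 1)
    (h0 : ∀ x, p x x = 0) (h1 : ∀ x y, x ≠ y → p x y + p y x = 1) (hp : ∀ x y, 0 ≤ p x y)
    (hbd : ∀ x y, x ≠ y → b ≤ p x y ∧ p x y ≤ a) (u v : V) (k : ℕ) :
    ∀ (A : Finset V) (i : ℕ), A.card = k → u ∉ A → v ∉ A →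
      a ^ i * Phi p k (insert u A) u - b ^ i * Phi p k (insert v A) v ≤ a - b := by
  induction k with
  | zero =>
    intro A i hA _ _
    simpa [Phi] using pow_sub_le hb hab hs i
  | succ k ih =>
    intro A i hA hu hv
    rw [Phi_insert h0 k u A hu, Phi_insert h0 k v A hv]
    set c : ℝ := 2 / (((k : ℝ) + 2) * ((k : ℝ) + 1)) with hc
    have hc0 : 0 ≤ c := by positivity
    have key : ∀ y ∈ A, a ^ i * ((p u y + ∑ x ∈ A, p x y) * Phi p k (insert u (A.erase y)) u)
        - b ^ i * ((p v y + ∑ x ∈ A, p x y) * Phi p k (insert v (A.erase y)) v)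
        ≤ (1 + ∑ x ∈ A, p x y) * (a - b) := by
      intro y hy
      have hcard : (A.erase y).card = k := by rw [Finset.card_erase_of_mem hy, hA]; rfl
      have hu' : u ∉ A.erase y := fun h => hu (Finset.mem_of_mem_erase h)
      have hv' : v ∉ A.erase y := fun h => hv (Finset.mem_of_mem_erase h)
      have e1 := ih (A.erase y) i hcard hu' hv'
      have e2 := ih (A.erase y) (i+1) hcard hu' hv'
      have hfu := Phi_nonneg hp k (insert u (A.erase y)) u
      have hfv := Phi_nonneg hp k (insert v (A.erase y)) v
      have hsum : 0 ≤ ∑ x ∈ A, p x y := Finset.sum_nonneg fun x _ => hp x y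
      have huy := (hbd u y (fun h => hu (h ▸ hy))).2
      have hvy := (hbd v y (fun h => hv (h ▸ hy))).1
      have hai : 0 ≤ a ^ i := pow_nonneg (hb.trans hab) i
      have hbi : 0 ≤ b ^ i := pow_nonneg hb i
      generalize Phi p k (insert u (A.erase y)) u = fu at *
      generalize Phi p k (insert v (A.erase y)) v = fv at *
      generalize ∑ x ∈ A, p x y = σ at *
      rw [pow_succ, pow_succ] at e2
      have m1 := mul_le_mul_of_nonneg_right huy (mul_nonneg hai hfu)
      have m2 := mul_le_mul_of_nonneg_right hvy (mul_nonneg hbi hfv)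
      have m3 := mul_le_mul_of_nonneg_left e1 hsum
      nlinarith
    have hsum := Finset.sum_le_sum key
    rw [Finset.sum_sub_distrib, ← Finset.mul_sum, ← Finset.mul_sum, ← Finset.sum_mul,
      Finset.sum_add_distrib, total_weight h0 h1, hA] at hsum
    have hfin : c * (((∑ y ∈ A, (1:ℝ)) + ((k+1 : ℕ) : ℝ) * (((k+1 : ℕ) : ℝ) - 1) / 2) * (a - b))
        = a - b := by
      rw [Finset.sum_const, hA, hc]
      simp only [nsmul_eq_mul]
      push_cast
      field_simp
      ring
    have := mul_le_mul_of_nonneg_left hsum hc0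
    rw [hfin] at this
    linarith

lemma Phi_mono {p : V → V → ℝ}
    (h0 : ∀ x, p x x = 0) (hp : ∀ x y, 0 ≤ p x y)
    (u v : V) (k : ℕ) :
    ∀ (A : Finset V), A.card = k → u ∉ A → v ∉ A → (∀ y ∈ A, p u y ≤ p v y) →
      Phi p k (insert u A) u ≤ Phi p k (insert v A) v := by
  induction k with
  | zero =>
    intro A hA _ _ _
    simp [Phi]
  | succ k ih =>
    intro A hA hu hv hle
    rw [Phi_insert h0 k u A hu, Phi_insert h0 k v A hv]
    refine mul_le_mul_of_nonneg_left (Finset.sum_le_sum fun y hy => ?_) (by positivity)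
    have hcard : (A.erase y).card = k := by rw [Finset.card_erase_of_mem hy, hA]; rfl
    refine mul_le_mul (by linarith [hle y hy]) (ih _ hcard
      (fun h => hu (Finset.mem_of_mem_erase h)) (fun h => hv (Finset.mem_of_mem_erase h))
      (fun z hz => hle z (Finset.mem_of_mem_erase hz))) (Phi_nonneg hp _ _ _)
      (add_nonneg (hp _ _) (Finset.sum_nonneg fun x _ => hp x y))

/-- joint winning weight of two teams -/
noncomputable def Psi (p : V → V → ℝ) (u v : V) (m : ℕ) (A : Finset V) : ℝ :=
  Phi p (m + 1) (insert u (insert v A)) u + Phi p (m + 1) (insert u (insert v A)) v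

lemma Psi_rec {p : V → V → ℝ} (h0 : ∀ x, p x x = 0) (u v : V) (huv : u ≠ v) (m : ℕ)
    (A : Finset V) (hu : u ∉ A) (hv : v ∉ A) :
    Phi p (m + 1) (insert u (insert v A)) u + Phi p (m + 1) (insert u (insert v A)) v =
      2 / (((m : ℝ) + 2) * ((m : ℝ) + 1)) *
      ((p v u + ∑ x ∈ A, p x u) * Phi p m (insert v A) v
      + (p u v + ∑ x ∈ A, p x v) * Phi p m (insert u A) u
      + ∑ y ∈ A, (p u y + p v y + ∑ x ∈ A, p x y) *
        (Phi p m (insert u (insert v (A.erase y))) u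
          + Phi p m (insert u (insert v (A.erase y))) v)) := by
  have hu' : u ∉ insert v A := by simp [huv, hu]
  have e1 : (insert u (insert v A)).erase u = insert v A := Finset.erase_insert hu'
  have e2 : (insert u (insert v A)).erase v = insert u A := by
    rw [Finset.erase_insert_of_ne huv, Finset.erase_insert hv]
  have e3 : ∀ y ∈ A, (insert u (insert v A)).erase y = insert u (insert v (A.erase y)) := by
    intro y hy
    rw [Finset.erase_insert_of_ne (fun h : u = y => hu (h ▸ hy)),
      Finset.erase_insert_of_ne (fun h : v = y => hv (h ▸ hy))]
  simp only [Phi]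
  rw [← mul_add, ← Finset.sum_add_distrib]
  congr 1
  rw [Finset.sum_insert hu', Finset.sum_insert hv, e1, e2,
    Phi_notMem m (insert v A) u hu', Phi_notMem m (insert u A) v (by simp [huv.symm, hv])]
  rw [← add_assoc]
  congr 1
  · simp only [Finset.sum_insert hu', Finset.sum_insert hv, h0]
    ring
  · refine Finset.sum_congr rfl fun y hy => ?_
    rw [e3 y hy]
    simp only [Finset.sum_insert hu', Finset.sum_insert hv]
    ring

/-- The heart of the upper bound. -/
lemma gain_bound {p p' : V → V → ℝ} {a b : ℝ} (hb : 0 ≤ b) (hab : b ≤ a) (hs : a + b = 1)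
    (h0 : ∀ x, p x x = 0) (h1 : ∀ x y, x ≠ y → p x y + p y x = 1) (hp : ∀ x y, 0 ≤ p x y)
    (h0' : ∀ x, p' x x = 0) (h1' : ∀ x y, x ≠ y → p' x y + p' y x = 1)
    (hbd : ∀ x y, x ≠ y → p x y = b ∨ p x y = a) (u v : V) (huv : u ≠ v)
    (hagree : ∀ x y, ¬ ((x = u ∨ x = v) ∧ (y = u ∨ y = v)) → p x y = p' x y)
    (q : ℝ) (hq : q = p' u v - p u v) (hq0 : 0 ≤ q) (m : ℕ) :
    ∀ A : Finset V, A.card = m → u ∉ A → v ∉ A →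
      Psi p' u v m A - Psi p u v m A ≤ q * (a - b) / 3 ∧
      ((∀ y ∈ A, p u y ≤ p v y) → Psi p' u v m A - Psi p u v m A ≤ 0) := by
  have hbd' : ∀ x y, x ≠ y → b ≤ p x y ∧ p x y ≤ a := by
    intro x y hxy
    rcases hbd x y hxy with h | h <;> rw [h] <;> constructor <;> linarith
  have hK : 0 ≤ q * (a - b) / 3 := by
    have : 0 ≤ a - b := by linarith
    positivity
  have hag : ∀ x y, y ≠ u → y ≠ v → p' x y = p x y := fun x y h h' =>
    (hagree x y (by rintro ⟨_, h2 | h2⟩; exacts [h h2, h' h2])).symm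
  have hag2 : ∀ x y, x ≠ u → x ≠ v → p' x y = p x y := fun x y h h' =>
    (hagree x y (by rintro ⟨h2 | h2, _⟩; exacts [h h2, h' h2])).symm
  have step : ∀ (m : ℕ) (A : Finset V), u ∉ A → v ∉ A →
      Psi p' u v m A - Psi p u v m A = 2 / (((m : ℝ) + 2) * ((m : ℝ) + 1)) *
        (q * (Phi p m (insert u A) u - Phi p m (insert v A) v)
        + ∑ y ∈ A, (p u y + p v y + ∑ x ∈ A, p x y) *
        ((Phi p' m (insert u (insert v (A.erase y))) u
          + Phi p' m (insert u (insert v (A.erase y))) v) -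
          (Phi p m (insert u (insert v (A.erase y))) u
          + Phi p m (insert u (insert v (A.erase y))) v))) := by
    intro m A hu hv
    have neu : ∀ y ∈ A, y ≠ u := fun y hy h => hu (h ▸ hy)
    have nev : ∀ y ∈ A, y ≠ v := fun y hy h => hv (h ▸ hy)
    have cu : Phi p' m (insert u A) u = Phi p m (insert u A) u := by
      refine Phi_congr m _ _ fun x hx y hy => ?_
      rcases Finset.mem_insert.mp hx with rfl | hx
      · rcases Finset.mem_insert.mp hy with rfl | hy
        · rw [h0, h0']
        · exact hag _ _ (neu y hy) (nev y hy)
      · exact hag2 _ _ (neu x hx) (nev x hx)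
    have cv : Phi p' m (insert v A) v = Phi p m (insert v A) v := by
      refine Phi_congr m _ _ fun x hx y hy => ?_
      rcases Finset.mem_insert.mp hx with rfl | hx
      · rcases Finset.mem_insert.mp hy with rfl | hy
        · rw [h0, h0']
        · exact hag _ _ (neu y hy) (nev y hy)
      · exact hag2 _ _ (neu x hx) (nev x hx)
    unfold Psi
    rw [Psi_rec h0 u v huv m A hu hv, Psi_rec h0' u v huv m A hu hv, cu, cv, ← mul_sub]
    congr 1
    have s1 : ∑ x ∈ A, p' x u = ∑ x ∈ A, p x u :=
      Finset.sum_congr rfl fun x hx => hag2 x u (neu x hx) (nev x hx)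
    have s2 : ∑ x ∈ A, p' x v = ∑ x ∈ A, p x v :=
      Finset.sum_congr rfl fun x hx => hag2 x v (neu x hx) (nev x hx)
    have s3 : ∑ y ∈ A, (p' u y + p' v y + ∑ x ∈ A, p' x y) *
        (Phi p' m (insert u (insert v (A.erase y))) u
          + Phi p' m (insert u (insert v (A.erase y))) v) =
        ∑ y ∈ A, (p u y + p v y + ∑ x ∈ A, p x y) *
        (Phi p' m (insert u (insert v (A.erase y))) u
          + Phi p' m (insert u (insert v (A.erase y))) v) := by
      refine Finset.sum_congr rfl fun y hy => ?_
      rw [hag u y (neu y hy) (nev y hy), hag v y (neu y hy) (nev y hy)]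
      congr 2
      exact Finset.sum_congr rfl fun x hx => hag x y (neu y hy) (nev y hy)
    rw [s1, s2, s3]
    simp only [mul_sub, Finset.sum_sub_distrib]
    have e1 := h1 u v huv
    have e2 := h1' u v huv
    have e3 : p' v u = p v u - q := by linarith
    have e4 : p' u v = p u v + q := by linarith
    rw [e3, e4]
    ring
  induction m with
  | zero =>
    intro A hA hu hv
    have hA0 : A = ∅ := Finset.card_eq_zero.mp hA
    rw [step 0 A hu hv, hA0]
    simp [Phi]
    exact hK
  | succ m ih =>
    intro A hA hu hv
    have neu : ∀ y ∈ A, u ≠ y := fun y hy h => hu (h ▸ hy)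
    have nev : ∀ y ∈ A, v ≠ y := fun y hy h => hv (h ▸ hy)
    have ih' : ∀ y ∈ A, Psi p' u v m (A.erase y) - Psi p u v m (A.erase y) ≤ q * (a - b) / 3 ∧
      ((∀ z ∈ A.erase y, p u z ≤ p v z) →
        Psi p' u v m (A.erase y) - Psi p u v m (A.erase y) ≤ 0) := fun y hy =>
      ih (A.erase y) (by rw [Finset.card_erase_of_mem hy, hA]; rfl)
        (fun h => hu (Finset.mem_of_mem_erase h)) (fun h => hv (Finset.mem_of_mem_erase h))
    have hst := step (m + 1) A hu hv
    have hst' : Psi p' u v (m+1) A - Psi p u v (m+1) A =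
        2 / ((((m+1 : ℕ) : ℝ) + 2) * (((m+1 : ℕ) : ℝ) + 1)) *
        (q * (Phi p (m+1) (insert u A) u - Phi p (m+1) (insert v A) v)
        + ∑ y ∈ A, (p u y + p v y + ∑ x ∈ A, p x y) *
          (Psi p' u v m (A.erase y) - Psi p u v m (A.erase y))) := hst
    rw [hst']
    set D : V → ℝ := fun y => Psi p' u v m (A.erase y) - Psi p u v m (A.erase y) with hD
    set K : ℝ := q * (a - b) / 3 with hKdef
    have hσ : ∀ y, 0 ≤ ∑ x ∈ A, p x y := fun y => Finset.sum_nonneg fun x _ => hp x y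
    have hc0 : 0 ≤ 2 / ((((m+1 : ℕ) : ℝ) + 2) * (((m+1 : ℕ) : ℝ) + 1)) := by positivity
    have second : (∀ y ∈ A, p u y ≤ p v y) →
        2 / ((((m+1 : ℕ) : ℝ) + 2) * (((m+1 : ℕ) : ℝ) + 1)) *
        (q * (Phi p (m+1) (insert u A) u - Phi p (m+1) (insert v A) v)
        + ∑ y ∈ A, (p u y + p v y + ∑ x ∈ A, p x y) * D y) ≤ 0 := by
      intro hle
      refine mul_nonpos_of_nonneg_of_nonpos hc0 (add_nonpos ?_ (Finset.sum_nonpos fun y hy => ?_))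
      · exact mul_nonpos_of_nonneg_of_nonpos hq0
          (sub_nonpos.mpr (Phi_mono h0 hp u v (m+1) A hA hu hv hle))
      · exact mul_nonpos_of_nonneg_of_nonpos
          (add_nonneg (add_nonneg (hp _ _) (hp _ _)) (hσ y))
          ((ih' y hy).2 fun z hz => hle z (Finset.mem_of_mem_erase hz))
    refine ⟨?_, second⟩
    by_cases hle : ∀ y ∈ A, p u y ≤ p v y
    · exact (second hle).trans hK
    push Not at hle
    obtain ⟨w, hw, hwlt⟩ := hle
    have gap : q * (Phi p (m+1) (insert u A) u - Phi p (m+1) (insert v A) v) ≤ 3 * K := by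
      have := Phi_gap hb hab hs h0 h1 hp hbd' u v (m+1) A 0 hA hu hv
      simp only [pow_zero, one_mul] at this
      have := mul_le_mul_of_nonneg_left this hq0
      rw [hKdef]; linarith
    have ha1 : a ≤ 1 := by linarith
    have gen : ∀ y ∈ A, (p u y + p v y) * D y ≤ 2 * K := by
      intro y hy
      have h1 := (hbd' u y (neu y hy)).2
      have h2 := (hbd' v y (nev y hy)).2
      have h3 := mul_le_mul_of_nonneg_left (ih' y hy).1 (add_nonneg (hp u y) (hp v y))
      have h4 : (p u y + p v y) * K ≤ 2 * K := mul_le_mul_of_nonneg_right (by linarith) hK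
      exact h3.trans h4
    have plus1 : ∀ y ∈ A, p v y < p u y → (p u y + p v y) * D y ≤ K := by
      intro y hy hlt
      have h3 := mul_le_mul_of_nonneg_left (ih' y hy).1 (add_nonneg (hp u y) (hp v y))
      have : p u y + p v y = 1 := by
        rcases hbd u y (neu y hy) with h | h <;> rcases hbd v y (nev y hy) with h' | h' <;>
          rw [h, h'] at hlt ⊢ <;> linarith
      rw [this, one_mul, one_mul] at h3
      rw [this, one_mul]
      exact h3
    have pairsum : ∑ y ∈ A, (p u y + p v y) * D y ≤ (2 * (m + 1 : ℝ) - 2) * K := by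
      have cardE : (A.erase w).card = m := by rw [Finset.card_erase_of_mem hw, hA]; rfl
      rw [← Finset.add_sum_erase _ _ hw]
      by_cases h2 : ∀ y ∈ A.erase w, p u y ≤ p v y
      · have hDw : D w ≤ 0 := (ih' w hw).2 h2
        have t1 : (p u w + p v w) * D w ≤ 0 :=
          mul_nonpos_of_nonneg_of_nonpos (add_nonneg (hp _ _) (hp _ _)) hDw
        have t2 := Finset.sum_le_card_nsmul (A.erase w) (fun y => (p u y + p v y) * D y) (2*K)
          (fun y hy => gen y (Finset.mem_of_mem_erase hy))
        rw [cardE, nsmul_eq_mul] at t2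
        linarith
      · push Not at h2
        obtain ⟨z, hz, hzlt⟩ := h2
        have cardF : ((A.erase w).erase z).card = m - 1 := by
          rw [Finset.card_erase_of_mem hz, cardE]
        have hm : 1 ≤ m := cardE ▸ Finset.card_pos.mpr ⟨z, hz⟩
        rw [← Finset.add_sum_erase _ _ hz]
        have t2 := Finset.sum_le_card_nsmul ((A.erase w).erase z)
          (fun y => (p u y + p v y) * D y) (2*K)
          (fun y hy => gen y (Finset.mem_of_mem_erase (Finset.mem_of_mem_erase hy)))
        rw [cardF, nsmul_eq_mul, Nat.cast_sub hm] at t2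
        have t3 := plus1 w hw hwlt
        have t4 := plus1 z (Finset.mem_of_mem_erase hz) hzlt
        push_cast at t2
        linarith
    have rest : ∑ y ∈ A, (∑ x ∈ A, p x y) * D y ≤ ((m + 1 : ℝ) * m / 2) * K := by
      have := Finset.sum_le_sum (fun y hy => mul_le_mul_of_nonneg_left (ih' y hy).1 (hσ y))
      rw [← Finset.sum_mul, total_weight h0 h1, hA] at this
      push_cast at this
      have e : ((m:ℝ) + 1) * (m + 1 - 1) / 2 = (m + 1 : ℝ) * m / 2 := by ring
      rw [e] at this
      exact this
    have tot : q * (Phi p (m+1) (insert u A) u - Phi p (m+1) (insert v A) v)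
        + ∑ y ∈ A, (p u y + p v y + ∑ x ∈ A, p x y) * D y ≤
        (((m+1 : ℕ) : ℝ) + 2) * (((m+1 : ℕ) : ℝ) + 1) / 2 * K := by
      simp only [add_mul (p u _ + p v _), Finset.sum_add_distrib]
      push_cast
      linarith
    have := mul_le_mul_of_nonneg_left tot hc0
    refine this.trans (le_of_eq ?_)
    field_simp

end PhiBasics

/-! ## Expectations over outcomes -/

section Expect
variable {n : ℕ}

lemma sum_flip (e : MatchPair n) (φ : Bool → ℝ) (G : Outcome n → ℝ)
    (hG : ∀ o b, G (Function.update o e b) = G o) :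
    2 * ∑ o : Outcome n, φ (o e) * G o = (φ true + φ false) * ∑ o : Outcome n, G o := by
  have hinv : Function.Involutive (fun o : Outcome n => Function.update o e (!(o e))) := by
    intro o
    simp
  have h1 : ∑ o : Outcome n, φ (o e) * G o = ∑ o : Outcome n, φ (!(o e)) * G o := by
    rw [← Equiv.sum_comp hinv.toPerm]
    refine Finset.sum_congr rfl fun o _ => ?_
    simp [Function.Involutive.toPerm, hG]
  rw [two_mul]
  nth_rewrite 2 [h1]
  rw [← Finset.sum_add_distrib, Finset.mul_sum]
  refine Finset.sum_congr rfl fun o _ => ?_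
  cases o e <;> simp <;> ring

lemma prob_indep (T : ProbTournament n) (e : MatchPair n) (φ : Bool → ℝ) (g : Outcome n → ℝ)
    (hg : ∀ o b, g (Function.update o e b) = g o) :
    ∑ o : Outcome n, T.prob o * (φ (o e) * g o) =
      (T.p e.val.1 e.val.2 * φ true + T.p e.val.2 e.val.1 * φ false) *
        ∑ o : Outcome n, T.prob o * g o := by
  set W : Bool → ℝ := fun b => if b then T.p e.val.1 e.val.2 else T.p e.val.2 e.val.1 with hW
  set Q : Outcome n → ℝ := fun o => ∏ e' ∈ Finset.univ.erase e,
    (if o e' then T.p e'.val.1 e'.val.2 else T.p e'.val.2 e'.val.1) with hQ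
  have hprob : ∀ o, T.prob o = W (o e) * Q o := by
    intro o
    unfold ProbTournament.prob
    rw [← Finset.mul_prod_erase _ _ (Finset.mem_univ e)]
  have hQi : ∀ o b, Q (Function.update o e b) = Q o := by
    intro o b
    refine Finset.prod_congr rfl fun e' he' => ?_
    rw [Function.update_of_ne (Finset.ne_of_mem_erase he')]
  have A := sum_flip e (fun b => W b * φ b) (fun o => Q o * g o)
    (fun o b => by simp only [hQi, hg])
  have B := sum_flip e W (fun o => Q o * g o) (fun o b => by simp only [hQi, hg])
  have c := T.compl e.val.1 e.val.2 (ne_of_lt e.2)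
  have A' : ∑ o : Outcome n, T.prob o * (φ (o e) * g o) =
      ∑ o : Outcome n, W (o e) * φ (o e) * (Q o * g o) :=
    Finset.sum_congr rfl fun o _ => by rw [hprob]; ring
  have B' : ∑ o : Outcome n, T.prob o * g o = ∑ o : Outcome n, W (o e) * (Q o * g o) :=
    Finset.sum_congr rfl fun o _ => by rw [hprob]; ring
  rw [A', B']
  simp only [hW, if_true, Bool.false_eq_true, if_false] at A B ⊢
  rw [c, one_mul] at B
  rw [← B] at A
  linarith

/-- the matrix attached to an outcome -/
noncomputable def outMat (hi lo : Fin n → Fin n → ℝ) (o : Outcome n) (x y : Fin n) : ℝ :=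
  if x = y then 0 else if Outcome.beats o x y then hi x y else lo x y

/-- the mean matrix -/
noncomputable def meanMat (hi lo : Fin n → Fin n → ℝ) (T : ProbTournament n) (x y : Fin n) : ℝ :=
  if x = y then 0 else T.p x y * hi x y + T.p y x * lo x y

lemma beats_update {o : Outcome n} {e : MatchPair n} {b : Bool} {x y : Fin n}
    (h : (x, y) ≠ e.val) (h' : (y, x) ≠ e.val) :
    Outcome.beats (Function.update o e b) x y = Outcome.beats o x y := by
  unfold Outcome.beats
  split_ifs with h1 h2
  · rw [Function.update_of_ne]
    exact fun hh => h (congrArg Subtype.val hh)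
  · rw [Function.update_of_ne]
    exact fun hh => h' (congrArg Subtype.val hh)
  · rfl

lemma beats_swap (o : Outcome n) {x y : Fin n} (h : x ≠ y) :
    Outcome.beats o y x = !Outcome.beats o x y := by
  unfold Outcome.beats
  rcases lt_or_gt_of_ne h with h | h
  · simp [h, not_lt_of_gt h]
  · simp [h, not_lt_of_gt h]

lemma expect_Phi (T : ProbTournament n) (hi lo : Fin n → Fin n → ℝ) (k : ℕ) :
    ∀ (s : Finset (Fin n)) (i : Fin n), (∑ o : Outcome n, T.prob o = 1) →
    ∑ o : Outcome n, T.prob o * Phi (outMat hi lo o) k s i = Phi (meanMat hi lo T) k s i := by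
  induction k with
  | zero =>
    intro s i h
    simp only [Phi]
    rw [← Finset.sum_mul, h, one_mul]
  | succ k ih =>
    intro s i h1
    have key : ∀ y ∈ s, ∀ x ∈ s, ∑ o : Outcome n,
        T.prob o * (outMat hi lo o x y * Phi (outMat hi lo o) k (s.erase y) i) =
        meanMat hi lo T x y * Phi (meanMat hi lo T) k (s.erase y) i := by
      intro y hy x hx
      rw [← ih (s.erase y) i h1]
      by_cases hxy : x = y
      · simp [outMat, meanMat, hxy]
      have inv : ∀ e : MatchPair n, (e.val = (x, y) ∨ e.val = (y, x)) → ∀ (o : Outcome n) (b : Bool),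
          Phi (outMat hi lo (Function.update o e b)) k (s.erase y) i =
          Phi (outMat hi lo o) k (s.erase y) i := by
        intro e he o b
        refine Phi_congr k _ _ fun x' hx' y' hy' => ?_
        have hx2 := Finset.ne_of_mem_erase hx'
        have hy2 := Finset.ne_of_mem_erase hy'
        unfold outMat
        rw [beats_update]
        · rintro h; rcases he with he | he <;> rw [he] at h <;> simp at h <;> tauto
        · rintro h; rcases he with he | he <;> rw [he] at h <;> simp at h <;> tauto
      rcases lt_or_gt_of_ne hxy with hlt | hlt
      · have := prob_indep T ⟨(x, y), hlt⟩ (fun b => if b then hi x y else lo x y)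
          (fun o => Phi (outMat hi lo o) k (s.erase y) i) (inv _ (Or.inl rfl))
        simp only [if_true, Bool.false_eq_true, if_false] at this
        unfold meanMat
        rw [if_neg hxy, ← this]
        refine Finset.sum_congr rfl fun o _ => ?_
        congr 2
        simp [outMat, hxy, Outcome.beats, hlt]
      · have := prob_indep T ⟨(y, x), hlt⟩ (fun b => if b then lo x y else hi x y)
          (fun o => Phi (outMat hi lo o) k (s.erase y) i) (inv _ (Or.inr rfl))
        simp only [if_true, Bool.false_eq_true, if_false] at this
        unfold meanMat
        rw [if_neg hxy, add_comm, ← this]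
        refine Finset.sum_congr rfl fun o _ => ?_
        congr 2
        have : ¬ x < y := not_lt_of_gt hlt
        by_cases ho : o ⟨(y, x), hlt⟩ = true <;> simp [outMat, hxy, Outcome.beats, hlt, this, ho]
    simp only [Phi]
    simp only [Finset.mul_sum, Finset.sum_mul]
    rw [Finset.sum_comm]
    refine Finset.sum_congr rfl fun y hy => ?_
    rw [Finset.sum_comm]
    refine Finset.sum_congr rfl fun x hx => ?_
    rw [← key y hy x hx, Finset.mul_sum]
    refine Finset.sum_congr rfl fun o _ => ?_
    ring

lemma prob_nonneg (T : ProbTournament n) (o : Outcome n) : 0 ≤ T.prob o := by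
  unfold ProbTournament.prob
  refine Finset.prod_nonneg fun e _ => ?_
  split_ifs
  exacts [(T.mem_Icc _ _).1, (T.mem_Icc _ _).1]

lemma prob_sum (T : ProbTournament n) : ∑ o : Outcome n, T.prob o = 1 := by
  unfold ProbTournament.prob
  have := Fintype.prod_sum (fun (e : MatchPair n) (b : Bool) =>
    if b then T.p e.val.1 e.val.2 else T.p e.val.2 e.val.1)
  rw [← this]
  refine Finset.prod_eq_one fun e _ => ?_
  simp [T.compl e.val.1 e.val.2 (ne_of_lt e.2)]

end Expect

/-! ## The rule and the upper bound -/

/-- Randomized Death Match in polynomial form. -/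
noncomputable def dmRule : ∀ n : ℕ, Outcome n → Fin n → ℝ :=
  fun n o i => Phi (outMat (fun _ _ => 1) (fun _ _ => 0) o) (n - 1) Finset.univ i

lemma outMat_diag {n : ℕ} (hi lo : Fin n → Fin n → ℝ) (o : Outcome n) (x : Fin n) :
    outMat hi lo o x x = 0 := by simp [outMat]

lemma outMat_compl {n : ℕ} {hi lo : Fin n → Fin n → ℝ} (h : ∀ x y, x ≠ y → hi x y + lo y x = 1)
    (o : Outcome n) (x y : Fin n) (hxy : x ≠ y) :
    outMat hi lo o x y + outMat hi lo o y x = 1 := by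
  unfold outMat
  rw [if_neg hxy, if_neg hxy.symm, beats_swap o hxy]
  have h1 := h x y hxy
  have h2 := h y x hxy.symm
  cases Outcome.beats o x y <;> simp <;> linarith

lemma dmRule_isRule : IsTournamentRule dmRule := by
  constructor
  · intro n o i
    refine Phi_nonneg (fun x y => ?_) _ _ _
    unfold outMat
    split_ifs <;> norm_num
  · intro n hn o
    refine Phi_sum (outMat_diag _ _ o) (outMat_compl (by intros; norm_num) o) _ _ ?_
    rw [Finset.card_univ, Fintype.card_fin]; omega

lemma dmRule_condorcet : CondorcetConsistent dmRule := by
  intro n o i hi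
  have hn : 0 < n := i.pos
  refine Phi_condorcet (outMat_diag _ _ o) (outMat_compl (by intros; norm_num) o) i ?_ _ _ ?_
    (Finset.mem_univ i)
  · intro x hx
    simp [outMat, hx.symm, hi x hx]
  · rw [Finset.card_univ, Fintype.card_fin]; omega

/-- zero out the diagonal -/
noncomputable def offD {n : ℕ} (T : ProbTournament n) (x y : Fin n) : ℝ :=
  if x = y then 0 else T.p x y

lemma rP_dmRule {n : ℕ} (T : ProbTournament n) (i : Fin n) :
    rP dmRule T i = Phi (offD T) (n - 1) Finset.univ i := by
  unfold rP dmRule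
  rw [expect_Phi T _ _ _ _ _ (prob_sum T)]
  refine Phi_congr _ _ _ fun x _ y _ => ?_
  simp [meanMat, offD]

/-- strict version of the bound, for matrices -/
lemma strict_bound {n : ℕ} {p p' : Fin n → Fin n → ℝ} {a b : ℝ} (hb : 0 ≤ b) (hab : b ≤ a)
    (hs : a + b = 1)
    (h0 : ∀ x, p x x = 0) (h1 : ∀ x y, x ≠ y → p x y + p y x = 1) (hp : ∀ x y, 0 ≤ p x y)
    (h0' : ∀ x, p' x x = 0) (h1' : ∀ x y, x ≠ y → p' x y + p' y x = 1)
    (hp' : ∀ x y, 0 ≤ p' x y)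
    (hbd : ∀ x y, x ≠ y → p x y = b ∨ p x y = a) (u v : Fin n) (huv : u ≠ v)
    (hagree : ∀ x y, ¬ ((x = u ∨ x = v) ∧ (y = u ∨ y = v)) → p x y = p' x y) :
    (Phi p' (n - 1) Finset.univ u + Phi p' (n - 1) Finset.univ v) -
      (Phi p (n - 1) Finset.univ u + Phi p (n - 1) Finset.univ v) ≤ a * (a - b) / 3 := by
  set A : Finset (Fin n) := (Finset.univ.erase u).erase v with hA
  have hv : v ∈ Finset.univ.erase u := Finset.mem_erase.mpr ⟨huv.symm, Finset.mem_univ v⟩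
  have hcard : A.card = n - 1 - 1 := by
    rw [hA, Finset.card_erase_of_mem hv, Finset.card_erase_of_mem (Finset.mem_univ u),
      Finset.card_univ, Fintype.card_fin]
  have hn : 2 ≤ n := by
    have h1 := u.2
    have h2 := v.2
    have : (u : ℕ) ≠ v := fun h => huv (Fin.ext h)
    omega
  have huA : u ∉ A := by simp [hA]
  have hvA : v ∉ A := by simp [hA]
  have huni : (Finset.univ : Finset (Fin n)) = insert u (insert v A) := by
    rw [hA, Finset.insert_erase hv, Finset.insert_erase (Finset.mem_univ u)]
  have hn1 : n - 1 = (n - 1 - 1) + 1 := by omega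
  have main : ∀ {u v : Fin n}, u ≠ v → u ∉ A → v ∉ A → Finset.univ = insert u (insert v A) →
      (∀ x y, ¬ ((x = u ∨ x = v) ∧ (y = u ∨ y = v)) → p x y = p' x y) →
      0 ≤ p' u v - p u v →
      (Phi p' (n - 1) Finset.univ u + Phi p' (n - 1) Finset.univ v) -
      (Phi p (n - 1) Finset.univ u + Phi p (n - 1) Finset.univ v) ≤ a * (a - b) / 3 := by
    intro u v huv hu hv huni hagree hq
    have := (gain_bound hb hab hs h0 h1 hp h0' h1' hbd u v huv hagree _ rfl hq _ A hcard hu hv).1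
    unfold Psi at this
    rw [← hn1, ← huni] at this
    refine this.trans ?_
    have e1 := h1' u v huv
    have e2 := hp' v u
    have e3 : b ≤ p u v := by rcases hbd u v huv with h | h <;> rw [h]; exact hab
    have : p' u v - p u v ≤ a := by linarith
    have := mul_le_mul_of_nonneg_right this (sub_nonneg.mpr hab)
    linarith
  rcases le_total 0 (p' u v - p u v) with h | h
  · exact main huv huA hvA huni hagree h
  · have e1 := h1' u v huv
    have e2 := h1 u v huv
    have := main huv.symm hvA huA (huni.trans (Finset.insert_comm _ _ _))
      (fun x y h => hagree x y (by tauto)) (by linarith)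
    linarith

lemma pair_bound {ε : ℝ} (hε : ε ∈ Set.Icc (0 : ℝ) (1/2)) {n : ℕ} (T T' : ProbTournament n)
    (hT : WeaklyBounded ε n T) (u v : Fin n) (huv : u ≠ v) (had : Adjacent {u, v} T T') :
    rPS dmRule T' {u, v} - rPS dmRule T {u, v} ≤ ε/3 + 2*ε^2/3 := by
  obtain ⟨hε0, hε1⟩ := hε
  unfold rPS
  rw [Finset.sum_pair huv, Finset.sum_pair huv]
  simp only [rP_dmRule]
  have htarget : ε/3 + 2*ε^2/3 = (1/2 + ε) * ((1/2 + ε) - (1/2 - ε)) / 3 := by ring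
  rw [htarget]
  have had' : ∀ x y, ¬ ((x = u ∨ x = v) ∧ (y = u ∨ y = v)) → T.p x y = T'.p x y := by
    intro x y h
    exact had x y (by simpa using h)
  rcases hε0.eq_or_lt with h | hpos
  · subst h
    refine strict_bound (by norm_num) (by norm_num) (by norm_num) (fun x => by simp [offD])
      (fun x y hxy => by simp [offD, hxy, hxy.symm, T.compl x y hxy]) ?_ (fun x => by simp [offD])
      (fun x y hxy => by simp [offD, hxy, hxy.symm, T'.compl x y hxy]) ?_ ?_ u v huv ?_
    · intro x y; unfold offD; split_ifs; exacts [le_rfl, (T.mem_Icc _ _).1]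
    · intro x y; unfold offD; split_ifs; exacts [le_rfl, (T'.mem_Icc _ _).1]
    · intro x y hxy
      have := hT x y hxy
      simp only [Set.mem_Icc, sub_zero, add_zero] at this
      simp only [offD, if_neg hxy, sub_zero, add_zero]
      left; linarith
    · intro x y hh
      unfold offD
      rw [had' x y hh]
  · have _mixing : True := trivial
    let R : ProbTournament n :=
      { p := fun x y => if x = y then 0 else (T.p x y - (1/2 - ε)) / (2 * ε)
        mem_Icc := by
          intro x y
          split_ifs with hxy
          · simp
          · have := hT x y hxy
            simp only [Set.mem_Icc] at this ⊢
            constructor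
            · exact div_nonneg (by linarith) (by linarith)
            · rw [div_le_one (by linarith)]; linarith
        compl := by
          intro x y hxy
          have := T.compl x y hxy
          rw [if_neg hxy, if_neg hxy.symm, ← add_div, div_eq_one_iff_eq (by linarith)]
          linarith }
    let hi : Fin n → Fin n → ℝ := fun _ _ => 1/2 + ε
    let lo : Fin n → Fin n → ℝ := fun _ _ => 1/2 - ε
    let inS : Fin n → Fin n → Prop := fun x y => (x = u ∨ x = v) ∧ (y = u ∨ y = v)
    let hi' : Fin n → Fin n → ℝ := fun x y => if inS x y then T'.p x y else 1/2 + ε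
    let lo' : Fin n → Fin n → ℝ := fun x y => if inS x y then T'.p x y else 1/2 - ε
    have mean : ∀ x y, x ≠ y → R.p x y * (1/2 + ε) + R.p y x * (1/2 - ε) = T.p x y := by
      intro x y hxy
      have c := T.compl x y hxy
      simp only [R, if_neg hxy, if_neg hxy.symm]
      have : T.p y x = 1 - T.p x y := by linarith
      rw [this]
      field_simp
      ring
    have m1 : ∀ i, Phi (offD T) (n - 1) Finset.univ i =
        ∑ o : Outcome n, R.prob o * Phi (outMat hi lo o) (n - 1) Finset.univ i := by
      intro i
      rw [expect_Phi R _ _ _ _ _ (prob_sum R)]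
      refine Phi_congr _ _ _ fun x _ y _ => ?_
      unfold offD meanMat
      split_ifs with hxy
      · rfl
      · exact (mean x y hxy).symm
    have m2 : ∀ i, Phi (offD T') (n - 1) Finset.univ i =
        ∑ o : Outcome n, R.prob o * Phi (outMat hi' lo' o) (n - 1) Finset.univ i := by
      intro i
      rw [expect_Phi R _ _ _ _ _ (prob_sum R)]
      refine Phi_congr _ _ _ fun x _ y _ => ?_
      unfold offD meanMat
      by_cases hxy : x = y
      · rw [if_pos hxy, if_pos hxy]
      · rw [if_neg hxy, if_neg hxy]
        simp only [hi', lo']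
        by_cases hS : inS x y
        · rw [if_pos hS, if_pos hS, ← add_mul, R.compl x y hxy, one_mul]
        · rw [if_neg hS, if_neg hS, mean x y hxy, had' x y hS]
    rw [m1, m1, m2, m2, ← Finset.sum_add_distrib, ← Finset.sum_add_distrib,
      ← Finset.sum_sub_distrib]
    have hbound : ∀ o : Outcome n,
        (Phi (outMat hi' lo' o) (n - 1) Finset.univ u + Phi (outMat hi' lo' o) (n - 1) Finset.univ v)
        - (Phi (outMat hi lo o) (n - 1) Finset.univ u + Phi (outMat hi lo o) (n - 1) Finset.univ v)
        ≤ (1/2 + ε) * ((1/2 + ε) - (1/2 - ε)) / 3 := by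
      intro o
      refine strict_bound (by linarith) (by linarith) (by ring) (outMat_diag _ _ o)
        (outMat_compl (by intro x y _; simp only [hi, lo]; ring) o) ?_ (outMat_diag _ _ o)
        (outMat_compl ?_ o) ?_ ?_ u v huv ?_
      · intro x y
        simp only [outMat, hi, lo]
        split_ifs <;> linarith
      · intro x y hxy
        simp only [hi', lo', inS]
        by_cases hS : inS x y
        · rw [if_pos hS, if_pos ⟨hS.2, hS.1⟩, T'.compl x y hxy]
        · rw [if_neg hS, if_neg (fun h => hS ⟨h.2, h.1⟩)]; ring
      · intro x y
        have := (T'.mem_Icc x y).1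
        simp only [outMat, hi', lo']
        split_ifs <;> linarith
      · intro x y hxy
        simp only [outMat, hi, lo, if_neg hxy]
        split_ifs
        · right; rfl
        · left; rfl
      · intro x y hS
        simp only [outMat, hi, lo, hi', lo', inS, if_neg hS]
    calc _ = ∑ o : Outcome n, R.prob o * ((Phi (outMat hi' lo' o) (n - 1) Finset.univ u
            + Phi (outMat hi' lo' o) (n - 1) Finset.univ v)
            - (Phi (outMat hi lo o) (n - 1) Finset.univ u
            + Phi (outMat hi lo o) (n - 1) Finset.univ v)) :=
          Finset.sum_congr rfl fun o _ => by ring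
      _ ≤ ∑ o : Outcome n, R.prob o * ((1/2 + ε) * ((1/2 + ε) - (1/2 - ε)) / 3) :=
          Finset.sum_le_sum fun o _ => mul_le_mul_of_nonneg_left (hbound o) (prob_nonneg R o)
      _ = _ := by rw [← Finset.sum_mul, prob_sum, one_mul]

lemma upper_bound {ε : ℝ} (hε : ε ∈ Set.Icc (0 : ℝ) (1/2)) :
    alph dmRule 2 (WeaklyBounded ε) ≤ ε/3 + 2*ε^2/3 := by
  have hpos : 0 ≤ ε/3 + 2*ε^2/3 := by
    have := hε.1
    positivity
  unfold alph
  refine Real.sSup_le ?_ hpos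
  rintro x ⟨n, T, T', S, hT, hS, had, rfl⟩
  by_cases h2 : S.card = 2
  · obtain ⟨u, v, huv, rfl⟩ := Finset.card_eq_two.mp h2
    exact pair_bound hε T T' hT u v huv had
  · have h1 : S.card ≤ 1 := by omega
    have : rPS dmRule T' S = rPS dmRule T S := by
      unfold rPS
      refine Finset.sum_congr rfl fun i _ => ?_
      rw [rP_dmRule, rP_dmRule]
      refine Phi_congr _ _ _ fun x _ y _ => ?_
      unfold offD
      split_ifs with hxy
      · rfl
      · refine (had x y fun hh => hxy ?_).symm
        exact Finset.card_le_one.mp h1 x hh.1 y hh.2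
    rw [this, sub_self]
    exact hpos

/-! ## The lower bound -/

/-- outcome on three teams from the results of `0-1`, `0-2`, `1-2` -/
def mk3 (a b c : Bool) : Outcome 3 :=
  fun e => if e.val = (0, 1) then a else if e.val = (0, 2) then b else c

lemma univ3 : (Finset.univ : Finset (MatchPair 3)) =
    {⟨(0, 1), by decide⟩, ⟨(0, 2), by decide⟩, ⟨(1, 2), by decide⟩} := by
  decide

/-- outcomes on three teams are triples of booleans -/
def equiv3 : (Bool × Bool × Bool) ≃ Outcome 3 where
  toFun t := mk3 t.1 t.2.1 t.2.2
  invFun o := (o ⟨(0, 1), by decide⟩, o ⟨(0, 2), by decide⟩, o ⟨(1, 2), by decide⟩)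
  left_inv := by rintro ⟨a, b, c⟩; rfl
  right_inv := by
    intro o
    funext e
    have he := Finset.mem_univ e
    rw [univ3] at he
    simp only [Finset.mem_insert, Finset.mem_singleton] at he
    rcases he with rfl | rfl | rfl <;> rfl

lemma sum3 (F : Outcome 3 → ℝ) : ∑ o : Outcome 3, F o =
    F (mk3 true true true) + F (mk3 true true false) + F (mk3 true false true)
    + F (mk3 true false false) + F (mk3 false true true) + F (mk3 false true false)
    + F (mk3 false false true) + F (mk3 false false false) := by
  rw [← Equiv.sum_comp equiv3]
  simp only [Fintype.sum_prod_type, Fintype.sum_bool, equiv3, Equiv.coe_fn_mk]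
  ring

/-- three-team tournament from the probabilities of `0-1`, `0-2`, `1-2` -/
noncomputable def T3 (x y z : ℝ) (hx : x ∈ Set.Icc (0:ℝ) 1) (hy : y ∈ Set.Icc (0:ℝ) 1)
    (hz : z ∈ Set.Icc (0:ℝ) 1) : ProbTournament 3 where
  p := ![![0, x, y], ![1 - x, 0, z], ![1 - y, 1 - z, 0]]
  mem_Icc := by
    intro i j
    obtain ⟨hx0, hx1⟩ := hx
    obtain ⟨hy0, hy1⟩ := hy
    obtain ⟨hz0, hz1⟩ := hz
    fin_cases i <;> fin_cases j <;> simp <;> (try constructor) <;> linarith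
  compl := by
    intro i j hij
    fin_cases i <;> fin_cases j <;> simp at hij ⊢

lemma prob3 {x y z : ℝ} (hx : x ∈ Set.Icc (0:ℝ) 1) (hy : y ∈ Set.Icc (0:ℝ) 1)
    (hz : z ∈ Set.Icc (0:ℝ) 1) (a b c : Bool) :
    (T3 x y z hx hy hz).prob (mk3 a b c) =
      (if a then x else 1 - x) * (if b then y else 1 - y) * (if c then z else 1 - z) := by
  unfold ProbTournament.prob
  rw [univ3, Finset.prod_insert (by decide), Finset.prod_insert (by decide),
    Finset.prod_singleton, ← mul_assoc]
  rfl

lemma rPS_bounds {r : ∀ n : ℕ, Outcome n → Fin n → ℝ} (hr : IsTournamentRule r) {n : ℕ}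
    (T : ProbTournament n) (S : Finset (Fin n)) : 0 ≤ rPS r T S ∧ rPS r T S ≤ 1 := by
  have hnn : ∀ i, 0 ≤ rP r T i := fun i =>
    Finset.sum_nonneg fun o _ => mul_nonneg (prob_nonneg T o) (hr.1 n o i)
  refine ⟨Finset.sum_nonneg fun i _ => hnn i, ?_⟩
  rcases Nat.eq_zero_or_pos n with h | h
  · subst h
    have : S = ∅ := Finset.eq_empty_of_forall_notMem fun i => i.elim0
    simp [rPS, this]
  · calc rPS r T S ≤ ∑ i, rP r T i :=
          Finset.sum_le_sum_of_subset_of_nonneg (Finset.subset_univ S) fun i _ _ => hnn i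
      _ = 1 := by
          unfold rP
          rw [Finset.sum_comm]
          rw [← prob_sum T]
          refine Finset.sum_congr rfl fun o _ => ?_
          rw [← Finset.mul_sum, hr.2 n h o, mul_one]

lemma alph_le {r : ∀ n : ℕ, Outcome n → Fin n → ℝ} (hr : IsTournamentRule r)
    {C : ∀ n : ℕ, ProbTournament n → Prop} {n : ℕ} {T T' : ProbTournament n} {S : Finset (Fin n)}
    (hC : C n T) (hS : S.card ≤ 2) (had : Adjacent S T T') :
    rPS r T' S - rPS r T S ≤ alph r 2 C := by
  unfold alph
  refine le_csSup ⟨1, ?_⟩ ⟨n, T, T', S, hC, hS, had, rfl⟩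
  rintro x ⟨n, T, T', S, -, -, -, rfl⟩
  have h1 := (rPS_bounds hr T' S).2
  have h2 := (rPS_bounds hr T S).1
  linarith

lemma lower_bound {ε : ℝ} (hε : ε ∈ Set.Icc (0 : ℝ) (1/2))
    {r : ∀ n : ℕ, Outcome n → Fin n → ℝ} (hr : IsTournamentRule r) (hc : CondorcetConsistent r) :
    ε/3 + 2*ε^2/3 ≤ alph r 2 (WeaklyBounded ε) := by
  obtain ⟨h0, h1⟩ := hε
  have ha : 1/2 + ε ∈ Set.Icc (0:ℝ) 1 := ⟨by linarith, by linarith⟩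
  have hb : 1/2 - ε ∈ Set.Icc (0:ℝ) 1 := ⟨by linarith, by linarith⟩
  have hzero : (0:ℝ) ∈ Set.Icc (0:ℝ) 1 := by simp
  have hone : (1:ℝ) ∈ Set.Icc (0:ℝ) 1 := by simp
  have hbd : WeaklyBounded ε 3 (T3 (1/2 + ε) (1/2 - ε) (1/2 + ε) ha hb ha) := by
    intro i j hij
    fin_cases i <;> fin_cases j <;> simp [T3] at hij ⊢ <;> (try constructor) <;> linarith
  have g1 := alph_le hr (T' := T3 0 (1/2 - ε) (1/2 + ε) hzero hb ha) (S := {0, 1}) hbd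
    (by decide) (by
      intro i j hij
      fin_cases i <;> fin_cases j <;> simp [T3] at hij ⊢)
  have g2 := alph_le hr (T' := T3 (1/2 + ε) (1/2 - ε) 0 ha hb hzero) (S := {1, 2}) hbd
    (by decide) (by
      intro i j hij
      fin_cases i <;> fin_cases j <;> simp [T3] at hij ⊢)
  have g3 := alph_le hr (T' := T3 (1/2 + ε) 1 (1/2 + ε) ha hone ha) (S := {0, 2}) hbd
    (by decide) (by
      intro i j hij
      fin_cases i <;> fin_cases j <;> simp [T3] at hij ⊢)
  have sm : ∀ o : Outcome 3, r 3 o 0 + r 3 o 1 + r 3 o 2 = 1 := by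
    intro o
    rw [← hr.2 3 (by norm_num) o, Fin.sum_univ_three]
  have nn := hr.1 3
  have c1 : r 3 (mk3 true true true) 0 = 1 := hc 3 _ 0 (by decide)
  have c2 : r 3 (mk3 true true false) 0 = 1 := hc 3 _ 0 (by decide)
  have c3 : r 3 (mk3 false true true) 1 = 1 := hc 3 _ 1 (by decide)
  have c4 : r 3 (mk3 false false true) 1 = 1 := hc 3 _ 1 (by decide)
  have c5 : r 3 (mk3 true false false) 2 = 1 := hc 3 _ 2 (by decide)
  have c6 : r 3 (mk3 false false false) 2 = 1 := hc 3 _ 2 (by decide)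
  have z0 : ∀ o, r 3 o 0 = 1 → r 3 o 1 = 0 ∧ r 3 o 2 = 0 := fun o h =>
    ⟨by linarith [sm o, nn o 1, nn o 2], by linarith [sm o, nn o 1, nn o 2]⟩
  have z1 : ∀ o, r 3 o 1 = 1 → r 3 o 0 = 0 ∧ r 3 o 2 = 0 := fun o h =>
    ⟨by linarith [sm o, nn o 0, nn o 2], by linarith [sm o, nn o 0, nn o 2]⟩
  have z2 : ∀ o, r 3 o 2 = 1 → r 3 o 0 = 0 ∧ r 3 o 1 = 0 := fun o h =>
    ⟨by linarith [sm o, nn o 0, nn o 1], by linarith [sm o, nn o 0, nn o 1]⟩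
  have s1 := sm (mk3 true false true)
  have s2 := sm (mk3 false true false)
  have e1 : r 3 (mk3 true false true) 2 =
    1 - r 3 (mk3 true false true) 0 - r 3 (mk3 true false true) 1 := by linarith
  have e2 : r 3 (mk3 false true false) 2 =
    1 - r 3 (mk3 false true false) 0 - r 3 (mk3 false true false) 1 := by linarith
  unfold rPS at g1 g2 g3
  rw [Finset.sum_pair (by decide), Finset.sum_pair (by decide)] at g1 g2 g3
  simp only [rP, sum3, prob3, c1, c2, c3, c4, c5, c6, (z0 _ c1).1, (z0 _ c1).2, (z0 _ c2).1,
    (z0 _ c2).2, (z1 _ c3).1, (z1 _ c3).2, (z1 _ c4).1, (z1 _ c4).2, (z2 _ c5).1, (z2 _ c5).2,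
    (z2 _ c6).1, (z2 _ c6).2, e1, e2, if_true, Bool.false_eq_true, if_false] at g1 g2 g3
  nlinarith [g1, g2, g3]

/-! ## Statement -/

theorem stmt17 (ε : ℝ) (hε : ε ∈ Set.Icc (0 : ℝ) (1/2)) :
    (∃ r : ∀ n : ℕ, Outcome n → Fin n → ℝ, IsTournamentRule r ∧ CondorcetConsistent r ∧
      alph r 2 (WeaklyBounded ε) ≤ ε/3 + 2*ε^2/3)
    ∧ ∀ r : ∀ n : ℕ, Outcome n → Fin n → ℝ, IsTournamentRule r → CondorcetConsistent r →
        ε/3 + 2*ε^2/3 ≤ alph r 2 (WeaklyBounded ε) := by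
  exact ⟨⟨dmRule, dmRule_isRule, dmRule_condorcet, upper_bound hε⟩, fun r hr hc => lower_bound hε hr hc⟩
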